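/- Let 0 < α < 1, r > 0 and C₁, C₂ ∈ ℝ, and set λ = r e^{iαπ/2}. Define x(t) = C₁ · Re(E_α(λ t^α)) + C₂ · Im(E_α(λ t^α)) and y(t) = −C₁ · Im(E_α(λ t^α)) + C₂ · Re(E_α(λ t^α)). Then lim_{t→∞} (x(t)² + y(t)²) = (C₁² + C₂²)/α²; i.e., the solution trajectory converges to the circle of radius √(C₁² + C₂²)/α centered at the origin. -/

import Mathlib

open Filter Real

/-- The two-parameter Mittag-Leffler function `E_{α,β}(z) = ∑_{k=0}^∞ z^k / Γ(αk + β)`. -/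
noncomputable def mittagLeffler (α β : ℝ) (z : ℂ) : ℂ :=
  ∑' k : ℕ, z ^ k / Complex.Gamma (α * k + β)

theorem integral_vertical_line_eq_of_pos {f : ℂ → ℂ} {m : ℝ → ℝ} {σ₁ σ₂ : ℝ}
    (h₁ : 0 < σ₁) (h₂ : σ₁ ≤ σ₂) (hf : DifferentiableOn ℂ f {s | 0 < s.re})
    (hm : MeasureTheory.Integrable m) (hm_top : Tendsto m atTop (nhds 0))
    (hm_bot : Tendsto m atBot (nhds 0))
    (hb : ∀ s : ℂ, 0 ≤ s.re → s.re ≤ σ₂ → s.im ≠ 0 → ‖f s‖ ≤ m s.im) :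
    ∫ y : ℝ, f (σ₁ + y * Complex.I) = ∫ y : ℝ, f (σ₂ + y * Complex.I) := by
  have hint : ∀ σ : ℝ, 0 < σ → σ ≤ σ₂ →
      MeasureTheory.Integrable fun y : ℝ => f (σ + y * Complex.I) := by
    intro σ hσ hσ₂
    refine hm.mono' (Continuous.aestronglyMeasurable ?_) ?_
    · exact hf.continuousOn.comp_continuous (by fun_prop) (by intro y; simpa using hσ)
    · filter_upwards [MeasureTheory.Measure.ae_ne MeasureTheory.volume (0 : ℝ)] with y hy
      simpa using hb (σ + y * Complex.I) (by simpa using hσ.le) (by simpa using hσ₂)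
        (by simpa using hy)
  have hlim : ∀ σ : ℝ, 0 < σ → σ ≤ σ₂ →
      Tendsto (fun T : ℝ => ∫ y in (-T)..T, f (σ + y * Complex.I)) atTop
        (nhds (∫ y : ℝ, f (σ + y * Complex.I))) := fun σ hσ hσ₂ =>
    MeasureTheory.intervalIntegral_tendsto_integral (hint σ hσ hσ₂) tendsto_neg_atTop_atBot
      tendsto_id
  have hside : ∀ τ : ℝ → ℝ, Tendsto (fun T => m (τ T)) atTop (nhds 0) →
      (∀ T, 0 < T → τ T ≠ 0) →
      Tendsto (fun T : ℝ => ∫ x in σ₁..σ₂, f (x + τ T * Complex.I)) atTop (nhds 0) := by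
    intro τ hτ hτ0
    refine squeeze_zero_norm' (a := fun T => m (τ T) * |σ₂ - σ₁|) ?_ (by simpa using hτ.mul_const _)
    filter_upwards [eventually_gt_atTop 0] with T hT
    refine intervalIntegral.norm_integral_le_of_norm_le_const fun x hx => ?_
    rw [Set.uIoc_of_le h₂] at hx
    simpa using hb (x + τ T * Complex.I) (by simpa using (h₁.trans hx.1).le)
      (by simpa using hx.2) (by simpa using hτ0 T hT)
  have hrect : ∀ T : ℝ, Complex.I * ((∫ y in (-T)..T, f (σ₂ + y * Complex.I)) -
      ∫ y in (-T)..T, f (σ₁ + y * Complex.I)) =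
      (∫ x in σ₁..σ₂, f (x + T * Complex.I)) -
        ∫ x in σ₁..σ₂, f (x + ((-T : ℝ) : ℂ) * Complex.I) := by
    intro T
    have := Complex.integral_boundary_rect_eq_zero_of_differentiableOn f
      (σ₁ + ((-T : ℝ) : ℂ) * Complex.I) (σ₂ + T * Complex.I) (hf.mono ?_)
    · simp only [Complex.add_re, Complex.ofReal_re, Complex.mul_re, Complex.I_re, mul_zero,
        Complex.ofReal_im, Complex.I_im, mul_one, sub_self, add_zero, Complex.add_im,
        Complex.mul_im, zero_add, smul_eq_mul] at this
      linear_combination this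
    · intro s hs
      have := hs.1
      simp only [Complex.add_re, Complex.ofReal_re, Complex.mul_re, Complex.I_re, mul_zero,
        Complex.ofReal_im, Complex.I_im, mul_one, sub_self, add_zero, Set.uIcc_of_le h₂,
        Set.mem_preimage] at this
      exact h₁.trans_le this.1
  have hleft := (((hlim σ₂ (h₁.trans_le h₂) le_rfl).sub (hlim σ₁ h₁ h₂)).const_mul Complex.I)
  have hright := (hside (fun T => T) hm_top fun T hT => hT.ne').sub
    (hside (fun T => -T) (hm_bot.comp tendsto_neg_atTop_atBot) fun T hT => by simpa using hT.ne')
  have := tendsto_nhds_unique (hleft.congr hrect) hright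
  simp only [sub_self, mul_eq_zero, Complex.I_ne_zero, false_or] at this
  exact (sub_eq_zero.mp this).symm

theorem integral_vertical_line_eq {f : ℂ → ℂ} {m : ℝ → ℝ} {σ : ℝ}
    (hσ : 0 < σ) (hf : DifferentiableOn ℂ f {s | 0 < s.re})
    (hc : ContinuousOn f {s | 0 ≤ s.re ∧ s ≠ 0})
    (hm : MeasureTheory.Integrable m) (hm_top : Tendsto m atTop (nhds 0))
    (hm_bot : Tendsto m atBot (nhds 0))
    (hb : ∀ s : ℂ, 0 ≤ s.re → s.re ≤ σ → s.im ≠ 0 → ‖f s‖ ≤ m s.im) :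
    ∫ y : ℝ, f (y * Complex.I) = ∫ y : ℝ, f (σ + y * Complex.I) := by
  have hlim : Tendsto (fun u : ℝ => ∫ y : ℝ, f (u + y * Complex.I)) (nhdsWithin 0 (Set.Ioi 0))
      (nhds (∫ y : ℝ, f (y * Complex.I))) := by
    refine MeasureTheory.tendsto_integral_filter_of_dominated_convergence m ?_ ?_ hm ?_
    · filter_upwards [self_mem_nhdsWithin] with u (hu : 0 < u)
      exact (hf.continuousOn.comp_continuous (by fun_prop)
        (by intro y; simpa using hu)).aestronglyMeasurable
    · filter_upwards [Ioc_mem_nhdsGT hσ] with u hu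
      filter_upwards [MeasureTheory.Measure.ae_ne MeasureTheory.volume (0 : ℝ)] with y hy
      simpa using hb (u + y * Complex.I) (by simpa using hu.1.le) (by simpa using hu.2)
        (by simpa using hy)
    · filter_upwards [MeasureTheory.Measure.ae_ne MeasureTheory.volume (0 : ℝ)] with y hy
      have h := hc (y * Complex.I) ⟨by simp, by simpa using hy⟩
      refine h.tendsto.comp (tendsto_nhdsWithin_iff.mpr ⟨?_, ?_⟩)
      · have : Continuous fun u : ℝ => (u : ℂ) + y * Complex.I := by fun_prop
        simpa using (this.tendsto 0).mono_left nhdsWithin_le_nhds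
      · filter_upwards [self_mem_nhdsWithin] with u (hu : 0 < u)
        refine ⟨by simpa using hu.le, fun h => hy ?_⟩
        simpa using congrArg Complex.im h
  refine tendsto_nhds_unique hlim (tendsto_const_nhds.congr' ?_)
  filter_upwards [Ioc_mem_nhdsGT hσ] with u hu
  exact (integral_vertical_line_eq_of_pos hu.1 hu.2 hf hm hm_top hm_bot hb).symm

open FourierTransform in
/-- A function vanishes at infinity if its Laplace transform extends to the closed right
half-plane, away from the origin, with an integrable bound along vertical lines. -/
theorem tendsto_zero_of_laplace {h : ℝ → ℂ} {G : ℂ → ℂ} {m : ℝ → ℝ} {σ : ℝ} (hσ : 0 < σ)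
    (hh : ContinuousOn h (Set.Ioi 0))
    (hint : MeasureTheory.IntegrableOn (fun t : ℝ => Complex.exp (-(σ * t)) * h t) (Set.Ioi 0))
    (hG : DifferentiableOn ℂ G {s | 0 < s.re})
    (hc : ContinuousOn G {s | 0 ≤ s.re ∧ s ≠ 0})
    (hm : MeasureTheory.Integrable m) (hm_top : Tendsto m atTop (nhds 0))
    (hm_bot : Tendsto m atBot (nhds 0))
    (hb : ∀ s : ℂ, 0 ≤ s.re → s.im ≠ 0 → ‖G s‖ ≤ m s.im)
    (hL : ∀ s : ℂ, s.re = σ → ∫ t in Set.Ioi (0 : ℝ), Complex.exp (-(s * t)) * h t = G s) :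
    Tendsto h atTop (nhds 0) := by
  set φ : ℝ → ℂ := (Set.Ioi 0).indicator fun t : ℝ => Complex.exp (-(σ * t)) * h t with hφ
  have hφint : MeasureTheory.Integrable φ := (MeasureTheory.integrable_indicator_iff
    measurableSet_Ioi).mpr hint
  have hφF : 𝓕 φ = fun w : ℝ => G (σ + (2 * π * w : ℝ) * Complex.I) := by
    ext w
    rw [Real.fourier_eq', ← hL _ (by simp), ← MeasureTheory.integral_indicator measurableSet_Ioi]
    congr 1
    ext t
    by_cases ht : t ∈ Set.Ioi (0 : ℝ)
    · simp only [hφ, Set.indicator_of_mem ht, smul_eq_mul, ← mul_assoc, ← Complex.exp_add]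
      congr 2
      simp
      ring
    · simp [hφ, Set.indicator_of_notMem ht]
  have hGint : MeasureTheory.Integrable fun y : ℝ => G (σ + y * Complex.I) := by
    refine hm.mono' (Continuous.aestronglyMeasurable ?_) ?_
    · exact hG.continuousOn.comp_continuous (by fun_prop) (by intro y; simpa using hσ)
    · filter_upwards [MeasureTheory.Measure.ae_ne MeasureTheory.volume (0 : ℝ)] with y hy
      simpa using hb (σ + y * Complex.I) (by simpa using hσ.le) (by simpa using hy)
  have hFint : MeasureTheory.Integrable (𝓕 φ) := by
    rw [hφF]
    exact hGint.comp_mul_left' (R := 2 * π) (by positivity)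
  have key : ∀ t : ℝ, 0 < t →
      h t = ∫ w : ℝ, 𝐞 (-(w * -t)) • G ((2 * π * w : ℝ) * Complex.I) := by
    intro t ht
    have hinv := hφint.fourierInv_fourier_eq hFint (v := t) ?_
    · have hshift := integral_vertical_line_eq (f := fun s => Complex.exp (s * t) * G s)
        (m := fun y => exp (σ * t) * m y) hσ (by fun_prop) (by fun_prop) (hm.const_mul _)
        (by simpa using hm_top.const_mul _) (by simpa using hm_bot.const_mul _) ?_
      · have e₁ := MeasureTheory.Measure.integral_comp_mul_left
          (fun y : ℝ => Complex.exp (y * Complex.I * t) * G (y * Complex.I)) (2 * π)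
        have e₂ := MeasureTheory.Measure.integral_comp_mul_left
          (fun y : ℝ => Complex.exp ((σ + y * Complex.I) * t) * G (σ + y * Complex.I)) (2 * π)
        rw [← hshift, ← e₁] at e₂
        have e₃ : ∫ w : ℝ, 𝐞 (-(w * -t)) • G ((2 * π * w : ℝ) * Complex.I) =
            Complex.exp (σ * t) * 𝓕⁻ (𝓕 φ) t := by
          rw [hφF, Real.fourierInv_eq', ← MeasureTheory.integral_const_mul]
          convert e₂.symm using 1
          · congr 1
            ext w
            rw [Circle.smul_def, Real.fourierChar_apply, smul_eq_mul]
            congr 2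
            push_cast
            ring
          · congr 1
            ext w
            rw [smul_eq_mul, ← mul_assoc, ← Complex.exp_add]
            congr 2
            simp
            ring
        rw [e₃, hinv, hφ, Set.indicator_of_mem (Set.mem_Ioi.mpr ht), ← mul_assoc,
          ← Complex.exp_add]
        simp
      · intro s hs hsσ hs'
        rw [norm_mul, Complex.norm_exp]
        refine mul_le_mul (exp_le_exp.mpr ?_) (hb s hs hs') (norm_nonneg _) (exp_pos _).le
        simpa using mul_le_mul_of_nonneg_right hsσ ht.le
    · have : ContinuousAt (fun t : ℝ => Complex.exp (-(σ * t)) * h t) t :=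
        ContinuousAt.mul (by fun_prop) (hh.continuousAt (Ioi_mem_nhds ht))
      refine this.congr ?_
      filter_upwards [Ioi_mem_nhds ht] with u hu
      rw [hφ, Set.indicator_of_mem hu]
  have hRL := (Real.tendsto_integral_exp_smul_cocompact
    (fun w : ℝ => G ((2 * π * w : ℝ) * Complex.I))).comp
    ((tendsto_neg_atTop_atBot (G := ℝ)).mono_right atBot_le_cocompact)
  refine hRL.congr' ?_
  filter_upwards [eventually_gt_atTop 0] with t ht
  exact (key t ht).symm

/-- A Laplace transform is determined on a right half-plane by its values on the real axis. -/
theorem laplace_eqOn_of_eq_real {h : ℝ → ℂ} {G : ℂ → ℂ} {σ : ℝ}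
    (hint : MeasureTheory.IntegrableOn (fun t : ℝ => Complex.exp (-(σ * t)) * h t) (Set.Ioi 0))
    (hG : DifferentiableOn ℂ G {s | σ < s.re})
    (hL : ∀ u : ℝ, σ < u → ∫ t in Set.Ioi (0 : ℝ), Complex.exp (-(u * t)) * h t = G u) :
    Set.EqOn (fun s : ℂ => ∫ t in Set.Ioi (0 : ℝ), Complex.exp (-(s * t)) * h t) G
      {s | σ < s.re} := by
  have hopen : IsOpen {s : ℂ | σ < s.re} := isOpen_lt continuous_const Complex.continuous_re
  have hfac : ∀ (s : ℂ) (t : ℝ), Complex.exp (-(s * t)) * h t =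
      Complex.exp (-((s - σ) * t)) * (Complex.exp (-(σ * t)) * h t) := fun s t => by
    rw [← mul_assoc, ← Complex.exp_add]
    congr 2
    ring
  have hmeas : ∀ s : ℂ, MeasureTheory.AEStronglyMeasurable
      (fun t : ℝ => Complex.exp (-(s * t)) * h t)
      (MeasureTheory.volume.restrict (Set.Ioi 0)) := fun s => by
    simp_rw [hfac s]
    exact (Continuous.aestronglyMeasurable (by fun_prop)).mul hint.aestronglyMeasurable
  have hdiff : DifferentiableOn ℂ
      (fun s : ℂ => ∫ t in Set.Ioi (0 : ℝ), Complex.exp (-(s * t)) * h t) {s | σ < s.re} := by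
    intro s hs
    have hs : σ < s.re := hs
    set δ : ℝ := (s.re - σ) / 2 with hδ
    have hδ0 : 0 < δ := by rw [hδ]; linarith
    have hball : ∀ z ∈ Metric.ball s δ, δ < z.re - σ := by
      intro z hz
      have h1 := (Complex.abs_re_le_norm (z - s)).trans_lt (mem_ball_iff_norm.mp hz)
      rw [Complex.sub_re] at h1
      have := (abs_lt.mp h1).1
      linarith
    refine (hasDerivAt_integral_of_dominated_loc_of_deriv_le
      (F := fun (z : ℂ) (t : ℝ) => Complex.exp (-(z * t)) * h t)
      (F' := fun (z : ℂ) (t : ℝ) => -(t : ℂ) * (Complex.exp (-(z * t)) * h t))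
      (bound := fun t : ℝ => δ⁻¹ * ‖Complex.exp (-(σ * t)) * h t‖)
      (Metric.ball_mem_nhds s hδ0) (Eventually.of_forall hmeas) ?_ ?_ ?_
      (hint.norm.const_mul _) ?_).2.differentiableAt.differentiableWithinAt
    · refine MeasureTheory.Integrable.mono hint (hmeas s) ?_
      filter_upwards [MeasureTheory.ae_restrict_mem measurableSet_Ioi] with t (ht : 0 < t)
      rw [hfac, norm_mul]
      refine mul_le_of_le_one_left (norm_nonneg _) ?_
      rw [Complex.norm_exp]
      refine exp_le_one_iff.mpr ?_
      simpa using mul_nonneg (sub_nonneg.mpr hs.le) ht.le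
    · exact (Continuous.aestronglyMeasurable (by fun_prop)).mul (hmeas s)
    · filter_upwards [MeasureTheory.ae_restrict_mem measurableSet_Ioi] with t (ht : 0 < t) z hz
      rw [hfac, ← mul_assoc, norm_mul]
      refine mul_le_mul_of_nonneg_right ?_ (norm_nonneg _)
      rw [norm_mul, norm_neg, Complex.norm_of_nonneg ht.le, Complex.norm_exp]
      have h1 : (-((z - σ) * t) : ℂ).re = -((z.re - σ) * t) := by simp
      rw [h1, exp_neg, ← div_eq_mul_inv, div_le_iff₀ (exp_pos _), inv_mul_eq_div,
        le_div_iff₀ hδ0]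
      have h2 := hball z hz
      have h3 := add_one_le_exp ((z.re - σ) * t)
      nlinarith
    · refine Eventually.of_forall fun t z _ => ?_
      have : HasDerivAt (fun z : ℂ => -(z * t)) (-(t : ℂ)) z :=
        ((hasDerivAt_id' z).mul_const (t : ℂ)).fun_neg.congr_deriv (by ring)
      refine (this.cexp.mul_const (h t)).congr_deriv ?_
      ring
  refine (hdiff.analyticOnNhd hopen).eqOn_of_preconnected_of_frequently_eq
    (hG.analyticOnNhd hopen) (convex_halfSpace_re_gt σ).isPreconnected
    (z₀ := ((σ + 1 : ℝ) : ℂ)) (by simp) ?_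
  have hto : Tendsto (fun u : ℝ => (u : ℂ)) (nhdsWithin (σ + 1) {σ + 1}ᶜ)
      (nhdsWithin ((σ + 1 : ℝ) : ℂ) {((σ + 1 : ℝ) : ℂ)}ᶜ) := by
    refine tendsto_nhdsWithin_iff.mpr ⟨?_, ?_⟩
    · exact (Complex.continuous_ofReal.tendsto _).mono_left nhdsWithin_le_nhds
    · filter_upwards [self_mem_nhdsWithin] with u hu
      exact fun h => hu (Complex.ofReal_injective h)
  refine hto.frequently (Eventually.frequently ?_)
  filter_upwards [nhdsWithin_le_nhds (Ioi_mem_nhds (lt_add_one σ))] with u hu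
  exact hL u hu

theorem rpow_mul_exp_neg_le_Gamma {a M : ℝ} (ha : 0 ≤ a) (hM : 0 ≤ M) :
    M ^ a * exp (-M) ≤ Gamma (a + 1) := by
  have hconv := GammaIntegral_convergent (s := a + 1) (by linarith)
  rw [Gamma_eq_integral (by linarith)]
  calc M ^ a * exp (-M) = ∫ x in Set.Ioi M, exp (-x) * M ^ a := by
        rw [MeasureTheory.integral_mul_const, integral_exp_neg_Ioi, mul_comm]
    _ ≤ ∫ x in Set.Ioi M, exp (-x) * x ^ (a + 1 - 1) := by
        refine MeasureTheory.setIntegral_mono_on ((integrableOn_exp_neg_Ioi M).mul_const _)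
          (hconv.mono_set (Set.Ioi_subset_Ioi hM)) measurableSet_Ioi fun x hx => ?_
        rw [add_sub_cancel_right]
        exact mul_le_mul_of_nonneg_left (rpow_le_rpow hM (le_of_lt hx) ha) (exp_pos _).le
    _ ≤ ∫ x in Set.Ioi 0, exp (-x) * x ^ (a + 1 - 1) := by
        refine MeasureTheory.setIntegral_mono_set hconv ?_
          (Set.Ioi_subset_Ioi hM).eventuallyLE
        filter_upwards [MeasureTheory.ae_restrict_mem measurableSet_Ioi] with x hx
        exact mul_nonneg (exp_pos _).le (rpow_nonneg (le_of_lt hx) _)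

theorem mittagLeffler_term_norm (α : ℝ) (z : ℂ) (k : ℕ) (hα : 0 < α) :
    ‖z ^ k / Complex.Gamma (α * k + (1 : ℝ))‖ = ‖z‖ ^ k / Gamma (α * k + 1) := by
  have : (α * k + (1 : ℝ) : ℂ) = ((α * k + 1 : ℝ) : ℂ) := by push_cast; rfl
  rw [norm_div, norm_pow, this, Complex.Gamma_ofReal,
    Complex.norm_of_nonneg (Gamma_pos_of_pos (by positivity)).le]

theorem mittagLeffler_term_norm_le {α c T : ℝ} (hα : 0 < α) (hc : 0 < c) (hcα : c ^ α = 2)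
    (hT : 0 < T) {z : ℂ} (hz : ‖z‖ ≤ T ^ α) (k : ℕ) :
    ‖z ^ k / Complex.Gamma (α * k + (1 : ℝ))‖ ≤ exp (c * T) * (1 / 2) ^ k := by
  have hΓ : 0 < Gamma (α * k + 1) := Gamma_pos_of_pos (by positivity)
  rw [mittagLeffler_term_norm α z k hα, div_le_iff₀ hΓ]
  calc ‖z‖ ^ k ≤ (T ^ α) ^ k := pow_le_pow_left₀ (norm_nonneg _) hz k
    _ = exp (c * T) * (1 / 2) ^ k * ((c * T) ^ (α * k) * exp (-(c * T))) := by
      rw [rpow_mul (by positivity), mul_rpow hc.le hT.le, hcα, rpow_natCast, mul_pow, exp_neg]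
      field_simp
      rw [← mul_pow]
      norm_num
    _ ≤ _ := by
      gcongr
      exact rpow_mul_exp_neg_le_Gamma (by positivity) (by positivity)

theorem mittagLeffler_norm_le {α c T : ℝ} (hα : 0 < α) (hc : 0 < c) (hcα : c ^ α = 2)
    (hT : 0 < T) {z : ℂ} (hz : ‖z‖ ≤ T ^ α) :
    ‖mittagLeffler α 1 z‖ ≤ exp (c * T) * 2 :=
  tsum_of_norm_bounded (hasSum_geometric_two.mul_left _)
    (mittagLeffler_term_norm_le hα hc hcα hT hz)

theorem continuous_mittagLeffler {α : ℝ} (hα : 0 < α) : Continuous (mittagLeffler α 1) := by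
  rw [continuous_iff_continuousAt]
  intro z
  set T : ℝ := (‖z‖ + 1) ^ α⁻¹ with hT
  have hTα : T ^ α = ‖z‖ + 1 := rpow_inv_rpow (by positivity) hα.ne'
  have hcα : ((2 : ℝ) ^ α⁻¹) ^ α = 2 := rpow_inv_rpow (by norm_num) hα.ne'
  have : ContinuousOn (mittagLeffler α 1) (Metric.ball 0 (‖z‖ + 1)) :=
    continuousOn_tsum (fun k => by fun_prop)
      (summable_geometric_two.mul_left (exp (2 ^ α⁻¹ * T))) fun k w hw =>
        mittagLeffler_term_norm_le hα (by positivity) hcα (by positivity)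
          (by rw [hTα]; exact (mem_ball_zero_iff.mp hw).le) k
  exact this.continuousAt (Metric.isOpen_ball.mem_nhds (by simp))

theorem integrableOn_exp_neg_mul_mittagLeffler {α c u : ℝ} (hα : 0 < α) (hc : 0 < c)
    (hcα : c ^ α = 2) (hu : c < u) {l : ℂ} (hl : ‖l‖ = 1) :
    MeasureTheory.IntegrableOn (fun t : ℝ => Complex.exp (-(u * t)) *
      mittagLeffler α 1 (l * ((t ^ α : ℝ) : ℂ))) (Set.Ioi 0) := by
  have hcont : Continuous fun t : ℝ => Complex.exp (-(u * t)) *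
      mittagLeffler α 1 (l * ((t ^ α : ℝ) : ℂ)) :=
    Continuous.mul (by fun_prop) ((continuous_mittagLeffler hα).comp
      (continuous_const.mul (Complex.continuous_ofReal.comp
        (continuous_id.rpow_const fun _ => Or.inr hα.le))))
  refine ((integrableOn_exp_mul_Ioi (a := -(u - c)) (by linarith) 0).mul_const 2).mono'
    hcont.aestronglyMeasurable ?_
  filter_upwards [MeasureTheory.ae_restrict_mem measurableSet_Ioi] with t (ht : 0 < t)
  have hz : ‖l * ((t ^ α : ℝ) : ℂ)‖ ≤ t ^ α := by
    rw [norm_mul, hl, one_mul, Complex.norm_of_nonneg (by positivity)]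
  rw [norm_mul]
  calc _ ≤ exp (-(u * t)) * (exp (c * t) * 2) := by
        gcongr
        · rw [Complex.norm_exp]
          simp
        · exact mittagLeffler_norm_le hα hc hcα ht hz
    _ = _ := by
        rw [← mul_assoc, ← exp_add]
        congr 2
        ring

theorem integral_exp_neg_mul_mittagLeffler {α u : ℝ} (hα : 0 < α) (hu : 1 < u) {l : ℂ}
    (hl : ‖l‖ = 1) :
    ∫ t in Set.Ioi (0 : ℝ), Complex.exp (-(u * t)) * mittagLeffler α 1 (l * ((t ^ α : ℝ) : ℂ)) =
      (u : ℂ) ^ (α - 1 : ℂ) / ((u : ℂ) ^ (α : ℂ) - l) := by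
  have hu0 : 0 < u := by linarith
  set q : ℝ := (u ^ α)⁻¹ with hq
  have hq0 : 0 < q := by positivity
  have hq1 : q < 1 := inv_lt_one_of_one_lt₀ (one_lt_rpow hu hα)
  have hΓ : ∀ k : ℕ, 0 < Gamma (α * k + 1) := fun k => Gamma_pos_of_pos (by positivity)
  have hterm : ∀ k : ℕ, Set.EqOn (fun t : ℝ => Complex.exp (-(u * t)) *
      ((l * ((t ^ α : ℝ) : ℂ)) ^ k / Complex.Gamma (α * k + (1 : ℝ))))
      (fun t : ℝ => l ^ k *
        ((t ^ (α * k + 1 - 1) * exp (-(u * t)) / Gamma (α * k + 1) : ℝ) : ℂ)) (Set.Ioi 0) := by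
    intro k t ht
    have h1 : (α * k + (1 : ℝ) : ℂ) = ((α * k + 1 : ℝ) : ℂ) := by push_cast; rfl
    have h2 : t ^ (α * k + 1 - 1) = (t ^ α) ^ k := by
      rw [add_sub_cancel_right, rpow_mul (le_of_lt ht), rpow_natCast]
    simp only [h1, Complex.Gamma_ofReal, h2]
    push_cast
    ring
  have hreal : ∀ k : ℕ, ∫ t in Set.Ioi (0 : ℝ),
      t ^ (α * k + 1 - 1) * exp (-(u * t)) / Gamma (α * k + 1) = u⁻¹ * q ^ k := by
    intro k
    rw [MeasureTheory.integral_div, integral_rpow_mul_exp_neg_mul_Ioi (by positivity) hu0,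
      mul_div_cancel_right₀ _ (hΓ k).ne', rpow_add (by positivity), rpow_one, one_div,
      rpow_mul (by positivity), rpow_natCast, inv_rpow hu0.le, mul_comm]
  have hrealint : ∀ k : ℕ, MeasureTheory.IntegrableOn (fun t : ℝ =>
      t ^ (α * k + 1 - 1) * exp (-(u * t)) / Gamma (α * k + 1)) (Set.Ioi 0) := fun k =>
    MeasureTheory.Integrable.of_integral_ne_zero (by rw [hreal]; positivity)
  have hsum := MeasureTheory.hasSum_integral_of_summable_integral_norm
    (μ := MeasureTheory.volume.restrict (Set.Ioi 0))
    (F := fun (k : ℕ) (t : ℝ) => Complex.exp (-(u * t)) *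
      ((l * ((t ^ α : ℝ) : ℂ)) ^ k / Complex.Gamma (α * k + (1 : ℝ)))) ?_ ?_
  · have hint : ∀ k : ℕ, ∫ t in Set.Ioi (0 : ℝ), Complex.exp (-(u * t)) *
        ((l * ((t ^ α : ℝ) : ℂ)) ^ k / Complex.Gamma (α * k + (1 : ℝ))) =
        (u : ℂ)⁻¹ * (l * q) ^ k := by
      intro k
      rw [MeasureTheory.setIntegral_congr_fun measurableSet_Ioi (hterm k),
        MeasureTheory.integral_const_mul, integral_complex_ofReal, hreal]
      push_cast
      ring
    simp only [hint, tsum_mul_left] at hsum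
    have hlq : ‖l * (q : ℂ)‖ < 1 := by
      rwa [norm_mul, hl, one_mul, Complex.norm_of_nonneg hq0.le]
    refine (hsum.unique ((hasSum_geometric_of_norm_lt_one hlq).mul_left _)).trans ?_
    have huC : (u : ℂ) ≠ 0 := by exact_mod_cast hu0.ne'
    have huα : (u : ℂ) ^ (α : ℂ) ≠ 0 := by simp [Complex.cpow_eq_zero_iff, huC]
    rw [hq, Complex.cpow_sub _ _ huC, Complex.cpow_one]
    push_cast
    rw [Complex.ofReal_cpow hu0.le]
    have hrw : 1 - l * ((u : ℂ) ^ (α : ℂ))⁻¹ = ((u : ℂ) ^ (α : ℂ) - l) / (u : ℂ) ^ (α : ℂ) := by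
      field_simp
    rw [hrw, inv_div]
    ring
  · intro k
    exact (MeasureTheory.IntegrableOn.congr_fun ((hrealint k).ofReal.const_mul (l ^ k))
      (hterm k).symm measurableSet_Ioi)
  · have hnorm : ∀ k : ℕ, ∫ t in Set.Ioi (0 : ℝ), ‖Complex.exp (-(u * t)) *
        ((l * ((t ^ α : ℝ) : ℂ)) ^ k / Complex.Gamma (α * k + (1 : ℝ)))‖ = u⁻¹ * q ^ k := by
      intro k
      rw [← hreal k]
      refine MeasureTheory.setIntegral_congr_fun measurableSet_Ioi fun t (ht : 0 < t) => ?_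
      have := hterm k (Set.mem_Ioi.mpr ht)
      simp only at this ⊢
      rw [this, norm_mul, norm_pow, hl, one_pow, one_mul, Complex.norm_of_nonneg]
      have := hΓ k
      positivity
    simp_rw [hnorm]
    exact (summable_geometric_of_lt_one hq0.le hq1).mul_left _

theorem integrable_min_abs_rpow {a b : ℝ} (ha : -1 < a) (hb : b < -1) :
    MeasureTheory.Integrable fun y : ℝ => min (|y| ^ a) (|y| ^ b) := by
  have hmeas : Measurable fun y : ℝ => min (|y| ^ a) (|y| ^ b) := by fun_prop
  have h₁ : MeasureTheory.IntegrableOn (fun y : ℝ => min (|y| ^ a) (|y| ^ b)) (Set.Ioc 0 1) := by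
    refine ((intervalIntegrable_iff_integrableOn_Ioc_of_le zero_le_one).mp
      (intervalIntegral.intervalIntegrable_rpow' ha)).mono' hmeas.aestronglyMeasurable ?_
    filter_upwards [MeasureTheory.ae_restrict_mem measurableSet_Ioc] with y hy
    rw [abs_of_pos hy.1, norm_of_nonneg (le_min (rpow_nonneg hy.1.le _) (rpow_nonneg hy.1.le _))]
    exact min_le_left _ _
  have h₂ : MeasureTheory.IntegrableOn (fun y : ℝ => min (|y| ^ a) (|y| ^ b)) (Set.Ioi 1) := by
    refine (integrableOn_Ioi_rpow_of_lt hb one_pos).mono' hmeas.aestronglyMeasurable ?_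
    filter_upwards [MeasureTheory.ae_restrict_mem measurableSet_Ioi] with y (hy : 1 < y)
    have hy0 : 0 ≤ y := by linarith
    rw [abs_of_nonneg hy0, norm_of_nonneg (le_min (rpow_nonneg hy0 _) (rpow_nonneg hy0 _))]
    exact min_le_right _ _
  have h₃ := (h₁.union h₂).integrable_indicator (measurableSet_Ioc.union measurableSet_Ioi)
  rw [Set.Ioc_union_Ioi_eq_Ioi zero_le_one] at h₃
  refine (h₃.add h₃.comp_neg).mono' hmeas.aestronglyMeasurable ?_
  filter_upwards [MeasureTheory.Measure.ae_ne MeasureTheory.volume (0 : ℝ)] with y hy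
  rw [norm_of_nonneg (by positivity)]
  rcases lt_or_gt_of_ne hy with h | h
  · simp [Set.indicator, h, not_lt.mpr h.le]
  · simp [Set.indicator, h, not_lt.mpr h.le]

theorem cpow_ofReal_injective {α : ℝ} (hα₀ : 0 < α) (hα₁ : α < 1) :
    Function.Injective fun s : ℂ => s ^ (α : ℂ) := by
  have hinv : ∀ s : ℂ, (s ^ (α : ℂ)) ^ ((α : ℂ)⁻¹) = s := by
    intro s
    have him : (Complex.log s * α).im = s.arg * α := by simp [Complex.log_im]
    have h1 := Complex.neg_pi_lt_arg s
    have h2 := Complex.arg_le_pi s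
    rw [← Complex.cpow_mul, mul_inv_cancel₀ (by exact_mod_cast hα₀.ne'), Complex.cpow_one]
    · rw [him]; nlinarith [pi_pos]
    · rw [him]; nlinarith [pi_pos]
  exact fun s t h => by rw [← hinv s, ← hinv t]; exact congrArg (· ^ ((α : ℂ)⁻¹)) h

theorem dslope_cpow_ne_zero {α : ℝ} (hα₀ : 0 < α) (hα₁ : α < 1) {a : ℂ}
    (ha : a ∈ Complex.slitPlane) (s : ℂ) : dslope (fun s : ℂ => s ^ (α : ℂ)) a s ≠ 0 := by
  rcases eq_or_ne s a with rfl | hs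
  · rw [dslope_same, ((hasDerivAt_id' s).cpow_const ha).deriv]
    have : s ≠ 0 := Complex.slitPlane_ne_zero ha
    simp [Complex.cpow_eq_zero_iff, this, hα₀.ne']
  · rw [dslope_of_ne _ hs, slope_def_field]
    exact div_ne_zero (sub_ne_zero.mpr ((cpow_ofReal_injective hα₀ hα₁).ne hs))
      (sub_ne_zero.mpr hs)

/-- The function `s ↦ s ^ (α - 1) / (s ^ α - I ^ α)` minus its polar part at `I` extends
holomorphically to the slit plane. -/
theorem exists_differentiableOn_cpow_div {α : ℝ} (hα₀ : 0 < α) (hα₁ : α < 1) :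
    ∃ H : ℂ → ℂ, DifferentiableOn ℂ H Complex.slitPlane ∧ ∀ s : ℂ, s ≠ Complex.I →
      H s = s ^ (α - 1 : ℂ) / (s ^ (α : ℂ) - Complex.I ^ (α : ℂ)) -
        (α : ℂ)⁻¹ / (s - Complex.I) := by
  have hI : Complex.I ∈ Complex.slitPlane := Or.inr (by simp)
  have hnhds : Complex.slitPlane ∈ nhds Complex.I := Complex.isOpen_slitPlane.mem_nhds hI
  have hαC : (α : ℂ) ≠ 0 := by exact_mod_cast hα₀.ne'
  have hpow : ∀ c : ℂ, DifferentiableOn ℂ (fun s : ℂ => s ^ c) Complex.slitPlane := fun c s hs =>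
    ((hasDerivAt_id s).cpow_const hs).differentiableAt.differentiableWithinAt
  set q := dslope (fun s : ℂ => s ^ (α : ℂ)) Complex.I with hq
  have hqd : DifferentiableOn ℂ q Complex.slitPlane :=
    (Complex.differentiableOn_dslope hnhds).mpr (hpow _)
  have hq0 : ∀ s, q s ≠ 0 := dslope_cpow_ne_zero hα₀ hα₁ hI
  set v : ℂ → ℂ := fun s => s ^ (α - 1 : ℂ) - (α : ℂ)⁻¹ * q s with hv
  have hvd : DifferentiableOn ℂ v Complex.slitPlane := (hpow _).sub (hqd.const_mul _)
  have hvI : v Complex.I = 0 := by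
    simp only [hv, hq, dslope_same]
    rw [((hasDerivAt_id' Complex.I).cpow_const hI).deriv]
    field_simp
    simp
  refine ⟨fun s => dslope v Complex.I s / q s,
    ((Complex.differentiableOn_dslope hnhds).mpr hvd).div hqd fun s _ => hq0 s, fun s hs => ?_⟩
  have hsI : s - Complex.I ≠ 0 := sub_ne_zero.mpr hs
  have hqs : q s = (s ^ (α : ℂ) - Complex.I ^ (α : ℂ)) / (s - Complex.I) := by
    rw [hq, dslope_of_ne _ hs, slope_def_field]
  have hne : s ^ (α : ℂ) - Complex.I ^ (α : ℂ) ≠ 0 :=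
    sub_ne_zero.mpr ((cpow_ofReal_injective hα₀ hα₁).ne hs)
  simp only [dslope_of_ne _ hs, slope_def_field, hvI, sub_zero]
  rw [hv]
  simp only [hqs]
  field_simp

theorem closed_right_half_subset_slitPlane {s : ℂ} (hs : 0 ≤ s.re) (hs0 : s ≠ 0) :
    s ∈ Complex.slitPlane := by
  rcases hs.lt_or_eq with h | h
  · exact Or.inl h
  · exact Or.inr fun him => hs0 (Complex.ext h.symm him)

theorem norm_I_cpow (α : ℝ) : ‖Complex.I ^ (α : ℂ)‖ = 1 := by
  rw [Complex.norm_cpow_real, Complex.norm_I, one_rpow]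

theorem norm_add_one_ge {s : ℂ} (hs : 0 ≤ s.re) : 1 ≤ ‖s + 1‖ ∧ ‖s‖ ≤ ‖s + 1‖ := by
  constructor
  · have := Complex.re_le_norm (s + 1)
    simp only [Complex.add_re, Complex.one_re] at this
    linarith
  · rw [Complex.norm_def, Complex.norm_def]
    refine sqrt_le_sqrt ?_
    simp only [Complex.normSq_apply, Complex.add_re, Complex.one_re, Complex.add_im,
      Complex.one_im, add_zero]
    nlinarith

theorem laplace_remainder_norm_le_near_zero {α : ℝ} (hα₀ : 0 < α) (hα₁ : α < 1) {s : ℂ}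
    (hs : 0 ≤ s.re) (hs0 : s ≠ 0) (hs1 : ‖s‖ ≤ 1 / 2) (hsα : ‖s‖ ^ α ≤ 1 / 2) :
    ‖s ^ (α - 1 : ℂ) / (s ^ (α : ℂ) - Complex.I ^ (α : ℂ)) - (α : ℂ)⁻¹ / (s - Complex.I) -
      (1 - (α : ℂ)⁻¹) / (s + 1)‖ ≤ (3 + 3 * α⁻¹) * ‖s‖ ^ (α - 1) := by
  have hn : 0 < ‖s‖ := norm_pos_iff.mpr hs0
  have hone : 1 ≤ ‖s‖ ^ (α - 1) :=
    one_le_rpow_of_pos_of_le_one_of_nonpos hn (by linarith) (by linarith)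
  have h1 : 1 / 2 ≤ ‖s ^ (α : ℂ) - Complex.I ^ (α : ℂ)‖ := by
    have := norm_sub_norm_le (Complex.I ^ (α : ℂ)) (s ^ (α : ℂ))
    rw [norm_I_cpow, Complex.norm_cpow_real, norm_sub_rev] at this
    linarith
  have h2 : 1 / 2 ≤ ‖s - Complex.I‖ := by
    have := norm_sub_norm_le Complex.I s
    rw [Complex.norm_I, norm_sub_rev] at this
    linarith
  have h3 := (norm_add_one_ge hs).1
  have e1 : ‖s ^ (α - 1 : ℂ) / (s ^ (α : ℂ) - Complex.I ^ (α : ℂ))‖ ≤ 2 * ‖s‖ ^ (α - 1) := by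
    have : (α - 1 : ℂ) = ((α - 1 : ℝ) : ℂ) := by push_cast; rfl
    rw [norm_div, this, Complex.norm_cpow_real, div_le_iff₀ (by linarith)]
    nlinarith
  have e2 : ‖(α : ℂ)⁻¹ / (s - Complex.I)‖ ≤ 2 * α⁻¹ := by
    rw [norm_div, norm_inv, Complex.norm_of_nonneg hα₀.le, div_le_iff₀ (by linarith)]
    nlinarith [inv_pos.mpr hα₀]
  have e3 : ‖(1 - (α : ℂ)⁻¹) / (s + 1)‖ ≤ 1 + α⁻¹ := by
    rw [norm_div, div_le_iff₀ (by linarith)]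
    have := norm_sub_le (1 : ℂ) (α : ℂ)⁻¹
    rw [norm_one, norm_inv, Complex.norm_of_nonneg hα₀.le] at this
    nlinarith [inv_pos.mpr hα₀]
  calc _ ≤ _ := norm_sub_le _ _
    _ ≤ _ := add_le_add_left (norm_sub_le _ _) _
    _ ≤ _ := add_le_add (add_le_add e1 e2) e3
    _ ≤ _ := by nlinarith [inv_pos.mpr hα₀]

theorem laplace_remainder_norm_le_at_infinity {α : ℝ} (hα₀ : 0 < α) (hα₁ : α < 1) {s : ℂ}
    (hs : 0 ≤ s.re) (hs1 : 2 ≤ ‖s‖) (hsα : 2 ≤ ‖s‖ ^ α) :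
    ‖s ^ (α - 1 : ℂ) / (s ^ (α : ℂ) - Complex.I ^ (α : ℂ)) - (α : ℂ)⁻¹ / (s - Complex.I) -
      (1 - (α : ℂ)⁻¹) / (s + 1)‖ ≤ (3 + 3 * α⁻¹) * ‖s‖ ^ (-1 - α) := by
  have hn : 0 < ‖s‖ := by linarith
  have hs0 : s ≠ 0 := norm_pos_iff.mp hn
  have hαC : (α : ℂ) ≠ 0 := by exact_mod_cast hα₀.ne'
  have h1 : ‖s‖ ^ α / 2 ≤ ‖s ^ (α : ℂ) - Complex.I ^ (α : ℂ)‖ := by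
    have := norm_sub_norm_le (s ^ (α : ℂ)) (Complex.I ^ (α : ℂ))
    rw [norm_I_cpow, Complex.norm_cpow_real] at this
    linarith
  have h2 : ‖s‖ / 2 ≤ ‖s - Complex.I‖ := by
    have := norm_sub_norm_le s Complex.I
    rw [Complex.norm_I] at this
    linarith
  have h3 := (norm_add_one_ge hs).2
  have n1 : s ^ (α : ℂ) - Complex.I ^ (α : ℂ) ≠ 0 := norm_pos_iff.mp (by linarith)
  have n2 : s - Complex.I ≠ 0 := norm_pos_iff.mp (by linarith)
  have n3 : s + 1 ≠ 0 := norm_pos_iff.mp (by linarith)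
  have hdecomp : s ^ (α - 1 : ℂ) / (s ^ (α : ℂ) - Complex.I ^ (α : ℂ)) -
      (α : ℂ)⁻¹ / (s - Complex.I) - (1 - (α : ℂ)⁻¹) / (s + 1) =
      Complex.I ^ (α : ℂ) / (s * (s ^ (α : ℂ) - Complex.I ^ (α : ℂ))) -
        (α : ℂ)⁻¹ * Complex.I / (s * (s - Complex.I)) +
        (1 - (α : ℂ)⁻¹) / (s * (s + 1)) := by
    rw [Complex.cpow_sub _ _ hs0, Complex.cpow_one]
    field_simp
    ring
  have hpow : ‖s‖ ^ (-1 - α) = (‖s‖ * ‖s‖ ^ α)⁻¹ := by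
    rw [← neg_add', rpow_neg hn.le, rpow_add hn, rpow_one]
  have hsα' : ‖s‖ ^ α ≤ ‖s‖ := by
    simpa using rpow_le_rpow_of_exponent_le (by linarith : 1 ≤ ‖s‖) hα₁.le
  have hle : (‖s‖ * ‖s‖)⁻¹ ≤ ‖s‖ ^ (-1 - α) := by
    rw [hpow]
    gcongr
  have e1 : ‖Complex.I ^ (α : ℂ) / (s * (s ^ (α : ℂ) - Complex.I ^ (α : ℂ)))‖ ≤
      2 * ‖s‖ ^ (-1 - α) := by
    rw [norm_div, norm_mul, norm_I_cpow, hpow]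
    calc 1 / (‖s‖ * ‖s ^ (α : ℂ) - Complex.I ^ (α : ℂ)‖) ≤ 1 / (‖s‖ * (‖s‖ ^ α / 2)) := by gcongr
      _ = _ := by field_simp
  have e2 : ‖(α : ℂ)⁻¹ * Complex.I / (s * (s - Complex.I))‖ ≤ 2 * α⁻¹ * ‖s‖ ^ (-1 - α) := by
    rw [norm_div, norm_mul, norm_mul, norm_inv, Complex.norm_of_nonneg hα₀.le, Complex.norm_I]
    calc α⁻¹ * 1 / (‖s‖ * ‖s - Complex.I‖) ≤ α⁻¹ * 1 / (‖s‖ * (‖s‖ / 2)) := by gcongr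
      _ = 2 * α⁻¹ * (‖s‖ * ‖s‖)⁻¹ := by field_simp
      _ ≤ _ := by gcongr
  have e3 : ‖(1 - (α : ℂ)⁻¹) / (s * (s + 1))‖ ≤ (1 + α⁻¹) * ‖s‖ ^ (-1 - α) := by
    have := norm_sub_le (1 : ℂ) (α : ℂ)⁻¹
    rw [norm_one, norm_inv, Complex.norm_of_nonneg hα₀.le] at this
    rw [norm_div, norm_mul]
    calc ‖1 - (α : ℂ)⁻¹‖ / (‖s‖ * ‖s + 1‖) ≤ (1 + α⁻¹) / (‖s‖ * ‖s‖) := by gcongr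
      _ = (1 + α⁻¹) * (‖s‖ * ‖s‖)⁻¹ := by rw [div_eq_mul_inv]
      _ ≤ _ := by gcongr
  rw [hdecomp]
  calc _ ≤ _ := norm_add_le _ _
    _ ≤ _ := add_le_add_left (norm_sub_le _ _) _
    _ ≤ _ := add_le_add (add_le_add e1 e2) e3
    _ = _ := by ring

/-- The part of the Laplace transform of `t ↦ E_α((I t)^α)` that is responsible for its behaviour
at infinity beyond the oscillation `exp (I t) / α`. -/
theorem exists_laplace_remainder {α : ℝ} (hα₀ : 0 < α) (hα₁ : α < 1) :
    ∃ (G : ℂ → ℂ) (C : ℝ), DifferentiableOn ℂ G {s | 0 ≤ s.re ∧ s ≠ 0} ∧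
      (∀ s : ℂ, s ≠ Complex.I → G s = s ^ (α - 1 : ℂ) / (s ^ (α : ℂ) - Complex.I ^ (α : ℂ)) -
        (α : ℂ)⁻¹ / (s - Complex.I) - (1 - (α : ℂ)⁻¹) / (s + 1)) ∧
      0 ≤ C ∧ ∀ s : ℂ, 0 ≤ s.re → s ≠ 0 → ‖G s‖ ≤ C * min (‖s‖ ^ (α - 1)) (‖s‖ ^ (-1 - α)) := by
  obtain ⟨H, hHd, hH⟩ := exists_differentiableOn_cpow_div hα₀ hα₁
  set G : ℂ → ℂ := fun s => H s - (1 - (α : ℂ)⁻¹) / (s + 1) with hG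
  have hGd : DifferentiableOn ℂ G {s | 0 ≤ s.re ∧ s ≠ 0} := by
    refine (hHd.mono fun s hs => closed_right_half_subset_slitPlane hs.1 hs.2).sub
      ((differentiableOn_const _).div (by fun_prop) fun s hs => ?_)
    exact norm_pos_iff.mp (one_pos.trans_le (norm_add_one_ge hs.1).1)
  have hGeq : ∀ s : ℂ, s ≠ Complex.I →
      G s = s ^ (α - 1 : ℂ) / (s ^ (α : ℂ) - Complex.I ^ (α : ℂ)) -
        (α : ℂ)⁻¹ / (s - Complex.I) - (1 - (α : ℂ)⁻¹) / (s + 1) := fun s hs => by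
    rw [hG]
    simp only [hH s hs]
  set R : ℝ := 2 ^ α⁻¹ with hR
  have hRα : R ^ α = 2 := rpow_inv_rpow (by norm_num) hα₀.ne'
  have hR2 : 2 ≤ R := by
    simpa using rpow_le_rpow_of_exponent_le (one_le_two : (1 : ℝ) ≤ 2)
      (one_le_inv_iff₀.mpr ⟨hα₀, hα₁.le⟩)
  have hR0 : 0 < R := by linarith
  have hK : IsCompact (Metric.closedBall (0 : ℂ) R ∩ {s | 0 ≤ s.re ∧ R⁻¹ ≤ ‖s‖}) :=
    (isCompact_closedBall _ _).inter_right
      ((isClosed_le continuous_const Complex.continuous_re).inter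
        (isClosed_le continuous_const continuous_norm))
  obtain ⟨B, hB⟩ := hK.exists_bound_of_continuousOn (f := G) (hGd.continuousOn.mono fun s hs =>
    ⟨hs.2.1, norm_pos_iff.mp ((inv_pos.mpr hR0).trans_le hs.2.2)⟩)
  refine ⟨G, 3 + 3 * α⁻¹ + |B| * R ^ (1 + α), hGd, hGeq, by positivity, fun s hs hs0 => ?_⟩
  have hn : 0 < ‖s‖ := norm_pos_iff.mpr hs0
  have hmin0 : 0 ≤ min (‖s‖ ^ (α - 1)) (‖s‖ ^ (-1 - α)) := by positivity
  have hα' := inv_pos.mpr hα₀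
  have hBR : 0 ≤ |B| * R ^ (1 + α) := by positivity
  rcases le_or_gt R ‖s‖ with hfar | hfar
  · have hmin : min (‖s‖ ^ (α - 1)) (‖s‖ ^ (-1 - α)) = ‖s‖ ^ (-1 - α) :=
      min_eq_right (rpow_le_rpow_of_exponent_le (by linarith) (by linarith))
    have hsI : s ≠ Complex.I := fun h => by
      rw [h, Complex.norm_I] at hfar
      linarith
    rw [hGeq s hsI]
    refine (laplace_remainder_norm_le_at_infinity hα₀ hα₁ hs (hR2.trans hfar) ?_).trans ?_
    · rw [← hRα]
      exact rpow_le_rpow hR0.le hfar hα₀.le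
    · rw [hmin] at hmin0 ⊢
      nlinarith
  rcases le_or_gt ‖s‖ R⁻¹ with hnear | hnear
  · have hRinv : R⁻¹ ≤ 1 / 2 := by
      rw [one_div]
      exact inv_anti₀ two_pos hR2
    have hmin : min (‖s‖ ^ (α - 1)) (‖s‖ ^ (-1 - α)) = ‖s‖ ^ (α - 1) :=
      min_eq_left (rpow_le_rpow_of_exponent_ge hn (by linarith) (by linarith))
    have hsI : s ≠ Complex.I := fun h => by
      rw [h, Complex.norm_I] at hnear
      linarith
    rw [hGeq s hsI]
    refine (laplace_remainder_norm_le_near_zero hα₀ hα₁ hs hs0 (hnear.trans hRinv) ?_).trans ?_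
    · refine (rpow_le_rpow hn.le hnear hα₀.le).trans ?_
      rw [inv_rpow hR0.le, hRα, one_div]
    · rw [hmin] at hmin0 ⊢
      nlinarith
  · have hBs : ‖G s‖ ≤ |B| :=
      (hB s ⟨by simpa using hfar.le, hs, hnear.le⟩).trans (le_abs_self B)
    have hR1 : 0 < R ^ (1 + α) := by positivity
    have hmin : 1 ≤ R ^ (1 + α) * min (‖s‖ ^ (α - 1)) (‖s‖ ^ (-1 - α)) := by
      have h1 : R ^ (1 + α) * R ^ (-1 - α) = 1 := by
        rw [← rpow_add hR0]
        simp
      refine h1.symm.trans_le ?_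
      refine mul_le_mul_of_nonneg_left (le_min ?_ ?_) hR1.le
      · exact (rpow_le_rpow_of_exponent_le (by linarith) (by linarith)).trans
          (rpow_le_rpow_of_nonpos hn hfar.le (by linarith))
      · exact rpow_le_rpow_of_nonpos hn hfar.le (by linarith)
    nlinarith [abs_nonneg B, mul_le_mul_of_nonneg_left hmin (abs_nonneg B)]

theorem exp_neg_mul_mul_exp (u a b : ℂ) (t : ℝ) :
    Complex.exp (-(u * t)) * (b * Complex.exp (a * t)) = b * Complex.exp ((a - u) * t) := by
  rw [mul_left_comm, ← Complex.exp_add]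
  congr 2
  ring

theorem integrableOn_exp_neg_mul_exp {u : ℝ} {a : ℂ} (hu : a.re < u) (b : ℂ) :
    MeasureTheory.IntegrableOn (fun t : ℝ => Complex.exp (-(u * t)) * (b * Complex.exp (a * t)))
      (Set.Ioi 0) := by
  simp_rw [exp_neg_mul_mul_exp]
  exact (integrableOn_exp_mul_complex_Ioi (by simpa using hu) 0).const_mul b

theorem integral_exp_neg_mul_exp {u : ℝ} {a : ℂ} (hu : a.re < u) (b : ℂ) :
    ∫ t in Set.Ioi (0 : ℝ), Complex.exp (-(u * t)) * (b * Complex.exp (a * t)) = b / (u - a) := by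
  simp_rw [exp_neg_mul_mul_exp]
  rw [MeasureTheory.integral_const_mul, integral_exp_mul_complex_Ioi (by simpa using hu)]
  simp only [Complex.ofReal_zero, mul_zero, Complex.exp_zero]
  rw [← neg_sub (u : ℂ) a, neg_div_neg_eq, mul_one_div]

theorem tendsto_mittagLeffler_sub_exp {α : ℝ} (hα₀ : 0 < α) (hα₁ : α < 1) :
    Tendsto (fun t : ℝ => mittagLeffler α 1 (Complex.I ^ (α : ℂ) * ((t ^ α : ℝ) : ℂ)) -
      (α : ℂ)⁻¹ * Complex.exp (Complex.I * t)) atTop (nhds 0) := by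
  obtain ⟨G, C, hGd, hGeq, hC, hGb⟩ := exists_laplace_remainder hα₀ hα₁
  set c : ℝ := 2 ^ α⁻¹ with hc
  have hc1 : 1 < c := one_lt_rpow one_lt_two (inv_pos.mpr hα₀)
  have hcα : c ^ α = 2 := rpow_inv_rpow (by norm_num) hα₀.ne'
  have hGpos : DifferentiableOn ℂ G {s | 0 < s.re} := hGd.mono fun s (hs : 0 < s.re) =>
    ⟨hs.le, fun h => by simp [h] at hs⟩
  set h : ℝ → ℂ := fun t => mittagLeffler α 1 (Complex.I ^ (α : ℂ) * ((t ^ α : ℝ) : ℂ)) -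
    (α : ℂ)⁻¹ * Complex.exp (Complex.I * t) - (1 - (α : ℂ)⁻¹) * Complex.exp (-1 * t) with hh
  have hcont : Continuous h := by
    refine (Continuous.sub ((continuous_mittagLeffler hα₀).comp
      (continuous_const.mul (Complex.continuous_ofReal.comp
        (continuous_id.rpow_const fun _ => Or.inr hα₀.le)))) (by fun_prop)).sub (by fun_prop)
  have hi₁ : ∀ u : ℝ, c < u → _ := fun u hu => integrableOn_exp_neg_mul_mittagLeffler hα₀
    (one_pos.trans hc1) hcα hu (norm_I_cpow α)
  have hi₂ : ∀ u : ℝ, c < u → _ := fun u hu => integrableOn_exp_neg_mul_exp (u := u)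
    (a := Complex.I) (by simp; linarith) (α : ℂ)⁻¹
  have hi₃ : ∀ u : ℝ, c < u → _ := fun u hu => integrableOn_exp_neg_mul_exp (u := u)
    (a := -1) (by simp; linarith) (1 - (α : ℂ)⁻¹)
  have hint : ∀ u : ℝ, c < u → MeasureTheory.IntegrableOn
      (fun t : ℝ => Complex.exp (-(u * t)) * h t) (Set.Ioi 0) := by
    intro u hu
    simp only [hh, mul_sub (Complex.exp _)]
    exact ((hi₁ u hu).sub (hi₂ u hu)).sub (hi₃ u hu)
  have hL : ∀ u : ℝ, c < u → ∫ t in Set.Ioi (0 : ℝ), Complex.exp (-(u * t)) * h t = G u := by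
    intro u hu
    rw [hGeq u fun e => by simpa using congrArg Complex.im e]
    simp only [hh, mul_sub (Complex.exp _)]
    have hsub := MeasureTheory.integral_sub ((hi₁ u hu).sub (hi₂ u hu)) (hi₃ u hu)
    simp only [Pi.sub_apply] at hsub
    rw [hsub,
      MeasureTheory.integral_sub (hi₁ u hu) (hi₂ u hu),
      integral_exp_neg_mul_mittagLeffler hα₀ (hc1.trans hu) (norm_I_cpow α),
      integral_exp_neg_mul_exp (by simp; linarith), integral_exp_neg_mul_exp (by simp; linarith),
      sub_neg_eq_add]
  have hLC := laplace_eqOn_of_eq_real (hint (c + 1) (lt_add_one c))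
    (hGpos.mono fun s (hs : c + 1 < s.re) => show 0 < s.re by linarith)
    fun u hu => hL u ((lt_add_one c).trans hu)
  have hm_top : Tendsto (fun y : ℝ => C * min (|y| ^ (α - 1)) (|y| ^ (-1 - α))) (cocompact ℝ)
      (nhds 0) := by
    have habs : Tendsto (fun y : ℝ => |y|) (cocompact ℝ) atTop := tendsto_norm_cocompact_atTop
    have hdecay : Tendsto (fun y : ℝ => |y| ^ (-1 - α)) (cocompact ℝ) (nhds 0) := by
      rw [← neg_add']
      exact (tendsto_rpow_neg_atTop (by linarith)).comp habs
    simpa using (squeeze_zero (fun y => by positivity) (fun y => min_le_right _ _)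
      hdecay).const_mul C
  have hzero := tendsto_zero_of_laplace (h := h) (σ := c + 2) (by linarith) hcont.continuousOn
    (hint _ (by linarith)) hGpos hGd.continuousOn
    ((integrable_min_abs_rpow (by linarith) (by linarith)).const_mul C)
    (hm_top.mono_left atTop_le_cocompact) (hm_top.mono_left atBot_le_cocompact) ?_
    fun s hs => hLC (show c + 1 < s.re by linarith)
  · have hexp : Tendsto (fun t : ℝ => (1 - (α : ℂ)⁻¹) * Complex.exp (-1 * t)) atTop (nhds 0) := by
      have : Tendsto (fun t : ℝ => ((exp (-t) : ℝ) : ℂ)) atTop (nhds 0) := by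
        exact_mod_cast (Complex.continuous_ofReal.tendsto 0).comp tendsto_exp_neg_atTop_nhds_zero
      simpa using this.const_mul (1 - (α : ℂ)⁻¹)
    simpa [hh] using hzero.add hexp
  · intro s hs him
    have hs0 : s ≠ 0 := fun e => him (by simp [e])
    have hle := Complex.abs_im_le_norm s
    have hpos : 0 < |s.im| := abs_pos.mpr him
    refine (hGb s hs hs0).trans (mul_le_mul_of_nonneg_left (min_le_min ?_ ?_) hC) <;>
      exact rpow_le_rpow_of_nonpos hpos hle (by linarith)

theorem tendsto_norm_mittagLeffler {α : ℝ} (hα₀ : 0 < α) (hα₁ : α < 1) :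
    Tendsto (fun t : ℝ => ‖mittagLeffler α 1 (Complex.I ^ (α : ℂ) * ((t ^ α : ℝ) : ℂ))‖) atTop
      (nhds α⁻¹) := by
  rw [tendsto_iff_norm_sub_tendsto_zero]
  refine squeeze_zero (fun _ => norm_nonneg _) (fun t => ?_)
    (tendsto_zero_iff_norm_tendsto_zero.mp (tendsto_mittagLeffler_sub_exp hα₀ hα₁))
  have hexp : ‖(α : ℂ)⁻¹ * Complex.exp (Complex.I * t)‖ = α⁻¹ := by
    rw [norm_mul, norm_inv, Complex.norm_of_nonneg hα₀.le, mul_comm Complex.I,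
      Complex.norm_exp_ofReal_mul_I, mul_one]
  rw [← hexp, norm_eq_abs, hexp]
  nth_rewrite 1 [← hexp]
  exact abs_norm_sub_norm_le _ _

/-- For `0 < α < 1`, `r > 0`, `λ = r e^{iαπ/2}`, and the trajectory
`x(t) = C₁ Re(E_α(λt^α)) + C₂ Im(E_α(λt^α))`,
`y(t) = −C₁ Im(E_α(λt^α)) + C₂ Re(E_α(λt^α))`, one has
`lim_{t→∞} (x(t)² + y(t)²) = (C₁² + C₂²)/α²`: the trajectory converges to the circle
of radius `√(C₁²+C₂²)/α` centered at the origin. -/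
theorem trajectory_tendsto_circle (α : ℝ) (hα₀ : 0 < α) (hα₁ : α < 1)
    (r : ℝ) (hr : 0 < r) (C₁ C₂ : ℝ) (lam : ℂ)
    (hlam : lam = (r : ℂ) * Complex.exp ((α * π / 2 : ℝ) * Complex.I))
    (x y : ℝ → ℝ)
    (hx : ∀ t : ℝ, x t =
      C₁ * (mittagLeffler α 1 (lam * ((t ^ α : ℝ) : ℂ))).re +
        C₂ * (mittagLeffler α 1 (lam * ((t ^ α : ℝ) : ℂ))).im)
    (hy : ∀ t : ℝ, y t =
      -C₁ * (mittagLeffler α 1 (lam * ((t ^ α : ℝ) : ℂ))).im +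
        C₂ * (mittagLeffler α 1 (lam * ((t ^ α : ℝ) : ℂ))).re) :
    Tendsto (fun t : ℝ => x t ^ 2 + y t ^ 2) atTop
      (nhds ((C₁ ^ 2 + C₂ ^ 2) / α ^ 2)) := by
  have hI : Complex.exp ((α * π / 2 : ℝ) * Complex.I) = Complex.I ^ (α : ℂ) := by
    rw [Complex.cpow_def_of_ne_zero Complex.I_ne_zero, Complex.log_I]
    congr 1
    push_cast
    ring
  have hscale : Tendsto (fun t : ℝ => r ^ α⁻¹ * t) atTop atTop :=
    tendsto_id.const_mul_atTop (rpow_pos_of_pos hr _)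
  have hlim := (((tendsto_norm_mittagLeffler hα₀ hα₁).comp hscale).pow 2).const_mul
    (C₁ ^ 2 + C₂ ^ 2)
  rw [inv_pow, ← div_eq_mul_inv] at hlim
  refine hlim.congr' ?_
  filter_upwards [eventually_ge_atTop 0] with t ht
  have harg : Complex.I ^ (α : ℂ) * (((r ^ α⁻¹ * t) ^ α : ℝ) : ℂ) =
      lam * ((t ^ α : ℝ) : ℂ) := by
    rw [mul_rpow (rpow_nonneg hr.le _) ht, rpow_inv_rpow hr.le hα₀.ne', hlam, hI]
    push_cast
    ring
  rw [hx, hy, Function.comp_apply, harg, Complex.sq_norm, Complex.normSq_apply]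
  ring
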